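/- The axiomatization BAPAL is sound: every theorem of the proof system BAPAL is a valid formula of L_BAPAL. -/

import Mathlib

/-- Boolean (propositional) formulas over atoms `P`. -/
inductive PLForm (P : Type) : Type
  | atom : P → PLForm P
  | neg : PLForm P → PLForm P
  | and : PLForm P → PLForm P → PLForm P

/-- The language L_BAPAL over agents `A` and atoms `P`. -/
inductive Form (A P : Type) : Type
  | atom : P → Form A P
  | neg : Form A P → Form A P
  | and : Form A P → Form A P → Form A P
  | know : A → Form A P → Form A P
  | ann : Form A P → Form A P → Form A P
  | box : Form A P → Form A P

def PLForm.toForm {A P : Type} : PLForm P → Form A P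
  | .atom p => .atom p
  | .neg φ => .neg φ.toForm
  | .and φ ψ => .and φ.toForm ψ.toForm

structure Model (A P : Type) where
  S : Type
  rel : A → S → S → Prop
  val : P → S → Prop

/-- An epistemic model: each accessibility relation is an equivalence relation. -/
def Model.IsEpistemic {A P : Type} (M : Model A P) : Prop :=
  ∀ a : A, Equivalence (M.rel a)

/-- Restriction of a model to a subset of its states. -/
def Model.restrict {A P : Type} (M : Model A P) (X : Set M.S) : Model A P where
  S := X
  rel a s t := M.rel a s.val t.val
  val p s := M.val p s.val

/-- Satisfaction of boolean formulas. -/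
def SatPL {A P : Type} (M : Model A P) (s : M.S) : PLForm P → Prop
  | .atom p => M.val p s
  | .neg φ => ¬ SatPL M s φ
  | .and φ ψ => SatPL M s φ ∧ SatPL M s ψ

/-- BAPAL satisfaction. -/
def Sat {A P : Type} : (M : Model A P) → M.S → Form A P → Prop
  | M, s, .atom p => M.val p s
  | M, s, .neg φ => ¬ Sat M s φ
  | M, s, .and φ ψ => Sat M s φ ∧ Sat M s ψ
  | M, s, .know a φ => ∀ t : M.S, M.rel a s t → Sat M t φ
  | M, s, .ann φ ψ => ∀ h : Sat M s φ, Sat (M.restrict {t | Sat M t φ}) ⟨s, h⟩ ψ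
  | M, s, .box ψ => ∀ (φ₀ : PLForm P) (h : SatPL M s φ₀),
      Sat (M.restrict {t | SatPL M t φ₀}) ⟨s, h⟩ ψ

def Valid {A P : Type} (φ : Form A P) : Prop :=
  ∀ M : Model A P, M.IsEpistemic → ∀ s : M.S, Sat M s φ

def Form.imp {A P : Type} (φ ψ : Form A P) : Form A P := .neg (.and φ (.neg ψ))
def Form.iff {A P : Type} (φ ψ : Form A P) : Form A P := .and (φ.imp ψ) (ψ.imp φ)
def Form.dia {A P : Type} (φ : Form A P) : Form A P := .neg (.box (.neg φ))
def Form.khat {A P : Type} (a : A) (φ : Form A P) : Form A P := .neg (.know a (.neg φ))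
def Form.diaAnn {A P : Type} (φ ψ : Form A P) : Form A P := .neg (.ann φ (.neg ψ))

def Form.occurs {A P : Type} (q : P) : Form A P → Prop
  | .atom p => p = q
  | .neg φ => φ.occurs q
  | .and φ ψ => φ.occurs q ∨ ψ.occurs q
  | .know _ φ => φ.occurs q
  | .ann φ ψ => φ.occurs q ∨ ψ.occurs q
  | .box φ => φ.occurs q

def Form.mapAtoms {A P Q : Type} (f : P → Q) : Form A P → Form A Q
  | .atom p => .atom (f p)
  | .neg φ => .neg (φ.mapAtoms f)
  | .and φ ψ => .and (φ.mapAtoms f) (ψ.mapAtoms f)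
  | .know a φ => .know a (φ.mapAtoms f)
  | .ann φ ψ => .ann (φ.mapAtoms f) (ψ.mapAtoms f)
  | .box φ => .box (φ.mapAtoms f)

/-- Propositional evaluation of a formula, treating atoms, knowledge formulas,
announcement formulas and box formulas as propositional atoms valued by `v`. -/
def evalProp {A P : Type} (v : Form A P → Bool) : Form A P → Bool
  | .neg φ => !(evalProp v φ)
  | .and φ ψ => evalProp v φ && evalProp v ψ
  | .atom p => v (.atom p)
  | .know a φ => v (.know a φ)
  | .ann φ ψ => v (.ann φ ψ)
  | .box φ => v (.box φ)

/-- `φ` is (an instance of) a propositional tautology. -/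
def Tautology {A P : Type} (φ : Form A P) : Prop :=
  ∀ v : Form A P → Bool, evalProp v φ = true

/-- The proof system BAPAL. -/
inductive Thm {A : Type} : Form A ℕ → Prop
  | taut {φ} : Tautology φ → Thm φ
  | axK {φ ψ} (a : A) : Thm (Form.imp (.know a (Form.imp φ ψ)) (Form.imp (.know a φ) (.know a ψ)))
  | axT {φ} (a : A) : Thm (Form.imp (.know a φ) φ)
  | ax4 {φ} (a : A) : Thm (Form.imp (.know a φ) (.know a (.know a φ)))
  | ax5 {φ} (a : A) : Thm (Form.imp (.neg (.know a φ)) (.know a (.neg (.know a φ))))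
  | axAP {φ} (p : ℕ) : Thm (Form.iff (.ann φ (.atom p)) (Form.imp φ (.atom p)))
  | axAN {φ ψ} : Thm (Form.iff (.ann φ (.neg ψ)) (Form.imp φ (.neg (.ann φ ψ))))
  | axAC {φ ψ χ} : Thm (Form.iff (.ann φ (.and ψ χ)) (.and (.ann φ ψ) (.ann φ χ)))
  | axAK {φ ψ} (a : A) : Thm (Form.iff (.ann φ (.know a ψ)) (Form.imp φ (.know a (.ann φ ψ))))
  | axAA {φ ψ χ} : Thm (Form.iff (.ann φ (.ann ψ χ)) (.ann (.and φ (.ann φ ψ)) χ))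
  | axABox {φ} (ψ₀ : PLForm ℕ) : Thm (Form.imp (.box φ) (.ann ψ₀.toForm φ))
  | mp {φ ψ} : Thm (Form.imp φ ψ) → Thm φ → Thm ψ
  | necK {φ} (a : A) : Thm φ → Thm (.know a φ)
  | necA {φ} (ψ : Form A ℕ) : Thm φ → Thm (.ann ψ φ)
  | rbox {ψ φ' φ : Form A ℕ} {p : ℕ} :
      ¬ ψ.occurs p → ¬ φ'.occurs p → ¬ φ.occurs p →
      Thm (Form.imp ψ (.ann φ' (.ann (.atom p) φ))) →
      Thm (Form.imp ψ (.ann φ' (.box φ)))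

theorem sat_ann {A P : Type} (M : Model A P) (s : M.S) (φ ψ : Form A P) :
    Sat M s (.ann φ ψ) ↔ ∀ h : Sat M s φ, Sat (M.restrict {t | Sat M t φ}) ⟨s, h⟩ ψ := by
  simp only [Sat]

theorem satPL_restrict {A P : Type} (M : Model A P) (X : Set M.S) (s : (M.restrict X).S)
    (φ : PLForm P) : SatPL (M.restrict X) s φ ↔ SatPL M s.val φ := by
  induction φ with
  | atom p => rfl
  | neg φ ih => simp only [SatPL, ih]
  | and φ ψ ih₁ ih₂ => simp only [SatPL, ih₁, ih₂]

theorem sat_toForm {A P : Type} (M : Model A P) (s : M.S) (φ : PLForm P) :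
    Sat M s φ.toForm ↔ SatPL M s φ := by
  induction φ with
  | atom p => simp only [PLForm.toForm, Sat, SatPL]
  | neg φ ih => simp only [PLForm.toForm, Sat, SatPL, ih]
  | and φ ψ ih₁ ih₂ => simp only [PLForm.toForm, Sat, SatPL, ih₁, ih₂]

theorem sat_imp {A P : Type} (M : Model A P) (s : M.S) (φ ψ : Form A P) :
    Sat M s (φ.imp ψ) ↔ (Sat M s φ → Sat M s ψ) := by
  simp only [Form.imp, Sat]
  tauto

theorem sat_iff {A P : Type} (M : Model A P) (s : M.S) (φ ψ : Form A P) :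
    Sat M s (φ.iff ψ) ↔ (Sat M s φ ↔ Sat M s ψ) := by
  simp only [Form.iff, Sat, sat_imp]
  tauto

theorem Model.IsEpistemic.restrict {A P : Type} {M : Model A P} (hM : M.IsEpistemic)
    (X : Set M.S) : (M.restrict X).IsEpistemic := fun a =>
  ⟨fun s => (hM a).refl s.val, fun h => (hM a).symm h, fun h h' => (hM a).trans h h'⟩

open Classical in
theorem Tautology.valid {A P : Type} {φ : Form A P} (h : Tautology φ) : Valid φ := by
  intro M _ s
  have key : ∀ χ : Form A P, evalProp (fun χ => decide (Sat M s χ)) χ = true ↔ Sat M s χ := by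
    intro χ
    induction χ with
    | neg φ ih => simp [evalProp, Sat, ← ih]
    | and φ ψ ih₁ ih₂ => simp [evalProp, Sat, ← ih₁, ← ih₂]
    | atom | know | ann | box => simp [evalProp]
  exact (key φ).1 (h _)

/-- A surjection between models that preserves and reflects accessibility and under which the two
models have the same boolean-definable sets, although individual atoms may be valued differently. -/
structure BoolMap {A P : Type} (M N : Model A P) where
  toFun : M.S → N.S
  surjective : Function.Surjective toFun
  rel_iff : ∀ a s t, M.rel a s t ↔ N.rel a (toFun s) (toFun t)
  exists_right : ∀ q, ∃ θ, ∀ s, M.val q s ↔ SatPL N (toFun s) θ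
  exists_left : ∀ q, ∃ θ, ∀ s, N.val q (toFun s) ↔ SatPL M s θ

namespace BoolMap

variable {A P : Type} {M N : Model A P}

/-- A `BoolMap` restricts to corresponding sets of states. -/
def restrict (e : BoolMap M N) (X : Set M.S) (Y : Set N.S)
    (h : ∀ s, s ∈ X ↔ e.toFun s ∈ Y) : BoolMap (M.restrict X) (N.restrict Y) where
  toFun s := ⟨e.toFun s.val, (h s.val).1 s.property⟩
  surjective t := by
    obtain ⟨s, hs⟩ := e.surjective t.val
    exact ⟨⟨s, (h s).2 (hs ▸ t.property)⟩, Subtype.ext hs⟩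
  rel_iff a s t := e.rel_iff a s.val t.val
  exists_right q := (e.exists_right q).imp fun _ hθ s =>
    (hθ s.val).trans (satPL_restrict N Y ⟨e.toFun s.val, (h s.val).1 s.property⟩ _).symm
  exists_left q := (e.exists_left q).imp fun _ hθ s =>
    (hθ s.val).trans (satPL_restrict M X _ _).symm

theorem exists_satPL_right (e : BoolMap M N) (φ : PLForm P) :
    ∃ θ, ∀ s, SatPL M s φ ↔ SatPL N (e.toFun s) θ := by
  induction φ with
  | atom p => exact e.exists_right p
  | neg φ ih =>
    obtain ⟨θ, hθ⟩ := ih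
    exact ⟨.neg θ, fun s => not_congr (hθ s)⟩
  | and φ ψ ih₁ ih₂ =>
    obtain ⟨θ₁, h₁⟩ := ih₁
    obtain ⟨θ₂, h₂⟩ := ih₂
    exact ⟨.and θ₁ θ₂, fun s => and_congr (h₁ s) (h₂ s)⟩

theorem exists_satPL_left (e : BoolMap M N) (φ : PLForm P) :
    ∃ θ, ∀ s, SatPL N (e.toFun s) φ ↔ SatPL M s θ := by
  induction φ with
  | atom p => exact e.exists_left p
  | neg φ ih =>
    obtain ⟨θ, hθ⟩ := ih
    exact ⟨.neg θ, fun s => not_congr (hθ s)⟩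
  | and φ ψ ih₁ ih₂ =>
    obtain ⟨θ₁, h₁⟩ := ih₁
    obtain ⟨θ₂, h₂⟩ := ih₂
    exact ⟨.and θ₁ θ₂, fun s => and_congr (h₁ s) (h₂ s)⟩

theorem sat_iff (φ : Form A P) {M N : Model A P} (e : BoolMap M N)
    (hφ : ∀ q, φ.occurs q → ∀ s, M.val q s ↔ N.val q (e.toFun s)) (s : M.S) :
    Sat M s φ ↔ Sat N (e.toFun s) φ := by
  induction φ generalizing M N with
  | atom p => simpa only [Sat] using hφ p rfl s
  | neg φ ih => simpa only [Sat] using not_congr (ih e hφ s)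
  | and φ ψ ih₁ ih₂ =>
    simpa only [Sat] using and_congr (ih₁ e (fun q hq => hφ q (.inl hq)) s)
      (ih₂ e (fun q hq => hφ q (.inr hq)) s)
  | know a φ ih =>
    simp only [Sat]
    rw [e.surjective.forall]
    exact forall_congr' fun t => imp_congr (e.rel_iff a s t) (ih e hφ t)
  | ann φ ψ ih₁ ih₂ =>
    have h₁ := ih₁ e fun q hq => hφ q (.inl hq)
    simp only [Sat]
    exact forall_prop_congr (fun h =>
      ih₂ (e.restrict {t | Sat M t φ} {t | Sat N t φ} h₁) (fun q hq t => hφ q (.inr hq) t.val)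
        ⟨s, h⟩) (h₁ s)
  | box φ ih =>
    simp only [Sat]
    constructor
    · intro H φ₀ h
      obtain ⟨θ, hθ⟩ := e.exists_satPL_left φ₀
      exact (ih (e.restrict {t | SatPL M t θ} {t | SatPL N t φ₀} fun t => (hθ t).symm)
        (fun q hq t => hφ q hq t.val) ⟨s, (hθ s).1 h⟩).1 (H θ _)
    · intro H φ₀ h
      obtain ⟨θ, hθ⟩ := e.exists_satPL_right φ₀
      exact (ih (e.restrict {t | SatPL M t φ₀} {t | SatPL N t θ} hθ)
        (fun q hq t => hφ q hq t.val) ⟨s, h⟩).2 (H θ ((hθ s).1 h))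

/-- Restricting twice amounts to a single restriction. -/
def restrictRestrict (M : Model A P) (X : Set M.S) (Y : Set (M.restrict X).S) (Z : Set M.S)
    (h : ∀ s, s ∈ Z ↔ ∃ hs : s ∈ X, (⟨s, hs⟩ : (M.restrict X).S) ∈ Y) :
    BoolMap ((M.restrict X).restrict Y) (M.restrict Z) where
  toFun s := ⟨s.val.val, (h _).2 ⟨s.val.property, s.property⟩⟩
  surjective s := ⟨⟨⟨s.val, ((h _).1 s.property).1⟩, ((h _).1 s.property).2⟩, rfl⟩
  rel_iff _ _ _ := Iff.rfl
  exists_right q := ⟨.atom q, fun _ => Iff.rfl⟩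
  exists_left q := ⟨.atom q, fun _ => Iff.rfl⟩

end BoolMap

theorem Form.exists_occurs_lt {A : Type} (φ : Form A ℕ) : ∃ n, ∀ q, φ.occurs q → q < n := by
  induction φ with
  | atom p => exact ⟨p + 1, fun q (hq : p = q) => by omega⟩
  | neg φ ih | know a φ ih | box φ ih => exact ih
  | and φ ψ ih₁ ih₂ | ann φ ψ ih₁ ih₂ =>
    obtain ⟨m, hm⟩ := ih₁
    obtain ⟨n, hn⟩ := ih₂
    refine ⟨max m n, fun q hq => ?_⟩
    rcases hq with hq | hq
    · exact lt_max_of_lt_left (hm q hq)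
    · exact lt_max_of_lt_right (hn q hq)

/-- The substitution that assigns `θ` to the atom `p`, fixes the other atoms below `n`, and
shifts the atoms from `n` on so as to make room for `p`. -/
def freshSubst (p n : ℕ) (θ : PLForm ℕ) (q : ℕ) : PLForm ℕ :=
  if q = p then θ else if q < n then .atom q else if q = n then .atom p else .atom (q - 1)

/-- The model in which each atom `q` is valued as the boolean formula `σ q`. -/
def Model.subst {A P : Type} (M : Model A P) (σ : P → PLForm P) : Model A P where
  S := M.S
  rel := M.rel
  val q s := SatPL M s (σ q)

/-- Revaluing `p` as `θ` by `freshSubst` does not change the boolean-definable sets. -/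
def BoolMap.freshSubst {A : Type} (M : Model A ℕ) {p n : ℕ} (hp : p < n) (θ : PLForm ℕ) :
    BoolMap M (M.subst (freshSubst p n θ)) where
  toFun s := s
  surjective := Function.surjective_id
  rel_iff _ _ _ := Iff.rfl
  exists_right q := by
    suffices h : ∃ r, _root_.freshSubst p n θ r = .atom q by
      obtain ⟨r, hr⟩ := h
      refine ⟨.atom r, fun s => ?_⟩
      simp only [SatPL, Model.subst, hr]
    by_cases hqp : q = p
    · exact ⟨n, by simp [_root_.freshSubst, hqp, hp.ne']⟩
    by_cases hqn : q < n
    · exact ⟨q, by simp [_root_.freshSubst, hqp, hqn]⟩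
    · refine ⟨q + 1, ?_⟩
      simp [_root_.freshSubst, show q + 1 ≠ p by omega, show ¬ q + 1 < n by omega,
        show q + 1 ≠ n by omega]
  exists_left q := ⟨_root_.freshSubst p n θ q, fun _ => Iff.rfl⟩

theorem valid_ann_box {A : Type} {ψ φ' φ : Form A ℕ} {p : ℕ} (hψ : ¬ ψ.occurs p)
    (hφ' : ¬ φ'.occurs p) (hφ : ¬ φ.occurs p)
    (h : Valid (ψ.imp (.ann φ' (.ann (.atom p) φ)))) : Valid (ψ.imp (.ann φ' (.box φ))) := by
  intro M hM s
  rw [sat_imp]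
  simp only [Sat]
  intro hs hs' θ hθ
  obtain ⟨n₁, hn₁⟩ := ψ.exists_occurs_lt
  obtain ⟨n₂, hn₂⟩ := φ'.exists_occurs_lt
  obtain ⟨n₃, hn₃⟩ := φ.exists_occurs_lt
  obtain ⟨n, hpn, h₁, h₂, h₃⟩ : ∃ n, p < n ∧ n₁ ≤ n ∧ n₂ ≤ n ∧ n₃ ≤ n :=
    ⟨p + 1 + n₁ + n₂ + n₃, by omega, by omega, by omega, by omega⟩
  let N := M.subst (freshSubst p n θ)
  let e : BoolMap M N := BoolMap.freshSubst M hpn θ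
  have agree : ∀ χ : Form A ℕ, ¬ χ.occurs p → (∀ q, χ.occurs q → q < n) →
      ∀ q, χ.occurs q → ∀ t, M.val q t ↔ N.val q t := by
    intro χ hχ hlt q hq t
    have hqp : q ≠ p := fun hqp => hχ (hqp ▸ hq)
    simp [N, Model.subst, freshSubst, hqp, hlt q hq, SatPL]
  have hp : ∀ t, N.val p t ↔ SatPL M t θ := fun t => by
    simp [N, Model.subst, freshSubst]
  have hψN := (e.sat_iff ψ (agree ψ hψ fun q hq => (hn₁ q hq).trans_le h₁) s).1 hs
  have hφ'N : ∀ t, Sat M t φ' ↔ Sat N t φ' :=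
    e.sat_iff φ' (agree φ' hφ' fun q hq => (hn₂ q hq).trans_le h₂)
  have hN := (sat_imp N s _ _).1 (h N hM s) hψN
  simp only [Sat] at hN
  let e₁ := e.restrict {t | Sat M t φ'} {t | Sat N t φ'} hφ'N
  let e₂ := e₁.restrict {t | SatPL _ t θ} {t | (N.restrict {t | Sat N t φ'}).val p t}
    fun t => (satPL_restrict M _ t θ).trans (hp t.val).symm
  exact (e₂.sat_iff φ
    (fun q hq t => agree φ hφ (fun q hq => (hn₃ q hq).trans_le h₃) q hq t.val.val)
    ⟨⟨s, hs'⟩, hθ⟩).2 (hN ((hφ'N s).1 hs') ((hp s).2 ((satPL_restrict M _ _ θ).1 hθ)))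

theorem sat_and_ann_iff {A P : Type} (M : Model A P) (s : M.S) (φ ψ : Form A P) :
    Sat M s (.and φ (.ann φ ψ)) ↔
      ∃ h : Sat M s φ, Sat (M.restrict {t | Sat M t φ}) ⟨s, h⟩ ψ := by
  simp only [Sat]
  exact ⟨fun h => ⟨h.1, h.2 h.1⟩, fun h => ⟨h.1, fun _ => h.2⟩⟩

theorem sat_ann_ann_iff {A P : Type} (M : Model A P) (s : M.S) (φ ψ χ : Form A P) :
    Sat M s (.ann φ (.ann ψ χ)) ↔ Sat M s (.ann (.and φ (.ann φ ψ)) χ) := by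
  let e := BoolMap.restrictRestrict M {t | Sat M t φ} {t | Sat _ t ψ}
    {t | Sat M t (.and φ (.ann φ ψ))} fun t => sat_and_ann_iff M t φ ψ
  have he : ∀ t, Sat _ t χ ↔ Sat _ (e.toFun t) χ :=
    e.sat_iff χ fun _ _ _ => Iff.rfl
  rw [sat_ann, sat_ann]
  constructor
  · intro H h
    obtain ⟨h₁, h₂⟩ := (sat_and_ann_iff M s φ ψ).1 h
    exact (he ⟨⟨s, h₁⟩, h₂⟩).1 ((sat_ann _ _ _ _).1 (H h₁) h₂)
  · intro H h
    exact (sat_ann _ _ _ _).2 fun h' => (he ⟨⟨s, h⟩, h'⟩).2 (H _)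

theorem sat_ann_toForm {A P : Type} (M : Model A P) (s : M.S) (φ : Form A P) (ψ₀ : PLForm P)
    (h : Sat M s (.box φ)) : Sat M s (.ann ψ₀.toForm φ) := by
  have transport : ∀ X Y : Set M.S, X = Y → ∀ (hX : s ∈ X) (hY : s ∈ Y),
      Sat (M.restrict X) ⟨s, hX⟩ φ → Sat (M.restrict Y) ⟨s, hY⟩ φ := by
    rintro X _ rfl _ _ H
    exact H
  simp only [Sat] at h
  rw [sat_ann]
  intro hs
  have h₀ := (sat_toForm M s ψ₀).1 hs
  exact transport _ _ (Set.ext fun t => (sat_toForm M t ψ₀).symm) h₀ hs (h ψ₀ h₀)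

/-- the axiomatization BAPAL is sound: every theorem is valid. -/
theorem bapal_sound {A : Type} [Countable A] (φ : Form A ℕ) (h : Thm φ) : Valid φ := by
  induction h with
  | taut h => exact h.valid
  | axK a =>
    intro M _ s
    simp only [sat_imp, Sat]
    exact fun h h' t ht => h t ht (h' t ht)
  | axT a =>
    intro M hM s
    simp only [sat_imp, Sat]
    exact fun h => h s ((hM a).refl s)
  | ax4 a =>
    intro M hM s
    simp only [sat_imp, Sat]
    exact fun h t ht u hu => h u ((hM a).trans ht hu)
  | ax5 a =>
    intro M hM s
    simp only [sat_imp, Sat]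
    exact fun h t ht h' => h fun u hu => h' u ((hM a).trans ((hM a).symm ht) hu)
  | axAP p =>
    intro M _ s
    simp only [sat_iff, sat_imp, Sat]
    exact Iff.rfl
  | axAN =>
    intro M _ s
    simp only [sat_iff, sat_imp, Sat]
    exact ⟨fun H h h' => H h (h' h), fun H h h' => H h fun _ => h'⟩
  | axAC =>
    intro M _ s
    simp only [sat_iff, Sat]
    exact forall_and
  | axAK a =>
    intro M _ s
    simp only [sat_iff, sat_imp, Sat]
    exact ⟨fun H h t ht h' => H h ⟨t, h'⟩ ht, fun H h t ht => H h t.val ht t.property⟩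
  | axAA => exact fun M _ s => (sat_iff _ _ _ _).2 (sat_ann_ann_iff M s _ _ _)
  | axABox ψ₀ => exact fun M _ s => (sat_imp _ _ _ _).2 (sat_ann_toForm M s _ ψ₀)
  | mp _ _ ih₁ ih₂ => exact fun M hM s => (sat_imp _ _ _ _).1 (ih₁ M hM s) (ih₂ M hM s)
  | necK a _ ih =>
    intro M hM s
    rw [Sat]
    exact fun t _ => ih M hM t
  | necA ψ _ ih =>
    intro M hM s
    rw [Sat]
    exact fun h => ih _ (hM.restrict _) ⟨s, h⟩
  | rbox hψ hφ' hφ _ ih => exact valid_ann_box hψ hφ' hφ ih
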